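/- For every real z ≠ 0 and all integers p ≥ 0 and ℓ ≥ 0: Σ_{k=0}^{ℓ} (2k+1)/(k−p−1/2)_{2p+3} · [j_k(z)]² = z²·A·[j_ℓ(z)]² + z²·B·[j_{ℓ+1}(z)]² + z·C·j_ℓ(z)·j_{ℓ+1}(z) + (1/(−p−1/2)_{2p+2})·Σ_{k=0}^{p} (−1)^k (p−k+1)_k · z^{−(k+1)} · j_{k+1}(2z), where A = −(1/2)·Σ_{k=0}^{p} (p−k+1)_k / [(p−k+1/2)_{k+1}·(ℓ−p+k+3/2)_{2p−2k+1}] · z^{−2k−2}, B = −(1/2)·Σ_{k=0}^{p} (p−k+1)_k / [(p−k+1/2)_{k+1}·(ℓ−p+k+1/2)_{2p−2k+1}] · z^{−2k−2}, and C = Σ_{k=0}^{p} (p−k+1)_k / [(p−k+1/2)_{k+1}·(ℓ−p+k+3/2)_{2p−2k}] · z^{−2k−2}. -/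

import Mathlib

open Finset

/-- Auxiliary: `sphjAux z n` is the spherical Bessel function `j_{n-1}(z)`. -/
noncomputable def sphjAux (z : ℝ) : ℕ → ℝ
  | 0 => Real.cos z / z
  | 1 => Real.sin z / z
  | (n + 2) => ((2 * (n : ℝ) + 1) / z) * sphjAux z (n + 1) - sphjAux z n

/-- The spherical Bessel function `j_k(z)` for integer `k ≥ -1`. -/
noncomputable def sphj (k : ℤ) (z : ℝ) : ℝ := sphjAux z (k + 1).toNat

/-- The Pochhammer symbol `(f)_n = f (f+1) ⋯ (f+n-1)`, with `(f)_0 = 1`. -/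
noncomputable def poch (f : ℝ) (n : ℕ) : ℝ := ∏ i ∈ Finset.range n, (f + (i : ℝ))

/-- Coefficient `A_ℓ^{[1],(p)}(z)` of the first hierarchy. -/
noncomputable def A1 (p ℓ : ℕ) (z : ℝ) : ℝ :=
  -(1 / 2) * ∑ k ∈ Finset.range (p + 1),
    poch ((p : ℝ) - k + 1) k /
      (poch ((p : ℝ) - k + 1 / 2) (k + 1) * poch ((ℓ : ℝ) - p + k + 3 / 2) (2 * p - 2 * k + 1)) *
      z ^ (-(2 * (k : ℤ)) - 2)

/-- Coefficient `B_ℓ^{[1],(p)}(z)` of the first hierarchy. -/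
noncomputable def B1 (p ℓ : ℕ) (z : ℝ) : ℝ :=
  -(1 / 2) * ∑ k ∈ Finset.range (p + 1),
    poch ((p : ℝ) - k + 1) k /
      (poch ((p : ℝ) - k + 1 / 2) (k + 1) * poch ((ℓ : ℝ) - p + k + 1 / 2) (2 * p - 2 * k + 1)) *
      z ^ (-(2 * (k : ℤ)) - 2)

/-- Coefficient `C_ℓ^{[1],(p)}(z)` of the first hierarchy. -/
noncomputable def C1 (p ℓ : ℕ) (z : ℝ) : ℝ :=
  ∑ k ∈ Finset.range (p + 1),
    poch ((p : ℝ) - k + 1) k /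
      (poch ((p : ℝ) - k + 1 / 2) (k + 1) * poch ((ℓ : ℝ) - p + k + 3 / 2) (2 * p - 2 * k)) *
      z ^ (-(2 * (k : ℤ)) - 2)


lemma poch_succ (f : ℝ) (n : ℕ) : poch f (n + 1) = poch f n * (f + n) := by
  simp [poch, Finset.prod_range_succ]

lemma poch_succ' (f : ℝ) (n : ℕ) : poch f (n + 1) = f * poch (f + 1) n := by
  simp only [poch, Finset.prod_range_succ']
  rw [mul_comm]
  congr 1
  · simp
  · apply Finset.prod_congr rfl
    intro i _
    push_cast
    ring

lemma poch_zero (f : ℝ) : poch f 0 = 1 := by simp [poch]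

lemma half_ne (m : ℤ) : (m : ℝ) + 1 / 2 ≠ 0 := by
  intro h
  have h2 : (2 * m + 1 : ℝ) = 0 := by linarith
  have h3 : (2 * m + 1 : ℤ) = 0 := by exact_mod_cast h2
  omega

lemma poch_half_ne (f : ℝ) (m : ℤ) (hf : f = m + 1 / 2) (n : ℕ) : poch f n ≠ 0 := by
  rw [poch, Finset.prod_ne_zero_iff]
  intro i _
  have := half_ne (m + i)
  rw [hf]
  push_cast at this
  intro h
  apply this
  linarith

/-- common coefficient -/
noncomputable def cc (p k : ℕ) : ℝ := poch ((p : ℝ) - k + 1) k / poch ((p : ℝ) - k + 1 / 2) (k + 1)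

lemma cc_rec (k n : ℕ) :
    cc (n + 1 + k) (k + 1) * (n + 1 / 2) = cc (n + 1 + k) k * (n + 1) := by
  unfold cc
  have e1 : ((n + 1 + k : ℕ) : ℝ) - (k + 1 : ℕ) + 1 = n + 1 := by push_cast; ring
  have e2 : ((n + 1 + k : ℕ) : ℝ) - (k + 1 : ℕ) + 1 / 2 = n + 1 / 2 := by push_cast; ring
  have e3 : ((n + 1 + k : ℕ) : ℝ) - k + 1 = n + 1 + 1 := by push_cast; ring
  have e4 : ((n + 1 + k : ℕ) : ℝ) - k + 1 / 2 = n + 1 / 2 + 1 := by push_cast; ring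
  rw [e1, e2, e3, e4, poch_succ' _ k, poch_succ' ((n : ℝ) + 1 / 2) (k + 1)]
  have h1 : (n : ℝ) + 1 / 2 ≠ 0 := by positivity
  have h2 : poch ((n : ℝ) + 1 / 2 + 1) (k + 1) ≠ 0 :=
    poch_half_ne _ (n + 1) (by push_cast; ring) _
  field_simp

lemma cc_zero (p : ℕ) : cc p 0 = 1 / (p + 1 / 2) := by
  simp [cc, poch]

noncomputable def AA (p : ℕ) (x w : ℝ) : ℝ :=
  ∑ k ∈ range (p + 1), cc p k / poch (x - p + k + 1) (2 * p - 2 * k + 1) * w ^ (k + 1)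
noncomputable def BB (p : ℕ) (x w : ℝ) : ℝ :=
  ∑ k ∈ range (p + 1), cc p k / poch (x - p + k) (2 * p - 2 * k + 1) * w ^ (k + 1)
noncomputable def CC (p : ℕ) (x w : ℝ) : ℝ :=
  ∑ k ∈ range (p + 1), cc p k / poch (x - p + k + 1) (2 * p - 2 * k) * w ^ (k + 1)

lemma pow_conv (z : ℝ) (k : ℕ) : z ^ (-(2 * (k : ℤ)) - 2) = ((z ^ 2)⁻¹) ^ (k + 1) := by
  have : (-(2 * (k : ℤ)) - 2) = -((2 * (k + 1) : ℕ) : ℤ) := by push_cast; ring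
  rw [this, zpow_neg, zpow_natCast, pow_mul, inv_pow]

lemma A1_eq (p ℓ : ℕ) (z : ℝ) : A1 p ℓ z = -(1 / 2) * AA p (ℓ + 1 / 2) ((z ^ 2)⁻¹) := by
  unfold A1 AA
  congr 1
  apply Finset.sum_congr rfl
  intro k _
  rw [pow_conv, cc, div_div]
  ring_nf

lemma B1_eq (p ℓ : ℕ) (z : ℝ) : B1 p ℓ z = -(1 / 2) * BB p (ℓ + 1 / 2) ((z ^ 2)⁻¹) := by
  unfold B1 BB
  congr 1
  apply Finset.sum_congr rfl
  intro k _
  rw [pow_conv, cc, div_div]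
  ring_nf

lemma C1_eq (p ℓ : ℕ) (z : ℝ) : C1 p ℓ z = CC p (ℓ + 1 / 2) ((z ^ 2)⁻¹) := by
  unfold C1 CC
  apply Finset.sum_congr rfl
  intro k _
  rw [pow_conv, cc, div_div]
  ring_nf

lemma AB (p : ℕ) (x w : ℝ) : AA p (x - 1) w = BB p x w := by
  unfold AA BB
  apply Finset.sum_congr rfl
  intro k _
  ring_nf

lemma half_ne' (x : ℝ) (m : ℤ) (hx : x = m + 1 / 2) (j : ℤ) : x + j ≠ 0 := by
  have := half_ne (m + j)
  push_cast at this
  rw [hx]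
  intro h
  apply this
  linarith

lemma CB (p : ℕ) (x w : ℝ) (m : ℤ) (hx : x = m + 1 / 2) :
    CC p x w + CC p (x - 1) w = 2 * x * BB p x w := by
  unfold CC BB
  rw [← Finset.sum_add_distrib, Finset.mul_sum]
  apply Finset.sum_congr rfl
  intro k hk
  obtain ⟨n, rfl⟩ : ∃ n, p = n + k := ⟨p - k, by simp at hk; omega⟩
  have s1 : 2 * (n + k) - 2 * k = 2 * n := by omega
  have e1 : x - ((n + k : ℕ) : ℝ) + k + 1 = x - n + 1 := by push_cast; ring
  have e2 : x - 1 - ((n + k : ℕ) : ℝ) + k + 1 = x - n := by push_cast; ring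
  have e3 : x - ((n + k : ℕ) : ℝ) + k = x - n := by push_cast; ring
  rw [s1, e1, e2, e3]
  have q1 : poch (x - n) (2 * n + 1) = (x - n) * poch (x - n + 1) (2 * n) := poch_succ' _ _
  have q2 : poch (x - n) (2 * n + 1) = poch (x - n) (2 * n) * (x + n) := by
    rw [poch_succ]; push_cast; ring
  have h1 : x - n ≠ 0 := by simpa [sub_eq_add_neg] using half_ne' x m hx (-n)
  have h2 : x + n ≠ 0 := by simpa using half_ne' x m hx n
  have h3 : poch (x - n) (2 * n + 1) ≠ 0 :=
    poch_half_ne _ (m - n) (by rw [hx]; push_cast; ring) _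
  have r1 : poch (x - n + 1) (2 * n) = poch (x - n) (2 * n + 1) / (x - n) := by
    rw [q1]; field_simp
  have r2 : poch (x - n) (2 * n) = poch (x - n) (2 * n + 1) / (x + n) := by
    rw [q2]; field_simp
  rw [r1, r2]
  field_simp
  ring

lemma diag (p : ℕ) (x z : ℝ) (hz : z ≠ 0) (m : ℤ) (hx : x = m + 1 / 2) :
    z ^ 2 * (-(1 / 2) * (AA p x ((z ^ 2)⁻¹) - BB p (x - 1) ((z ^ 2)⁻¹))) +
      2 * x * (x * BB p x ((z ^ 2)⁻¹) - CC p (x - 1) ((z ^ 2)⁻¹)) =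
      2 * x / poch (x - p - 1) (2 * p + 3) := by
  set w := (z ^ 2)⁻¹ with hw
  have hzw : z ^ 2 * w = 1 := by rw [hw]; field_simp
  let u : ℕ → ℝ := fun k => cc p k * (x * (2 * (p - k) + 1)) /
    poch (x - p + k - 1) (2 * p - 2 * k + 3) * w ^ k
  let v : ℕ → ℝ := fun k => cc p k * (2 * x * (p - k)) /
    poch (x - p + k) (2 * p - 2 * k + 1) * w ^ (k + 1)
  have hu : z ^ 2 * (-(1 / 2) * (AA p x w - BB p (x - 1) w)) = ∑ k ∈ range (p + 1), u k := by
    unfold AA BB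
    rw [← Finset.sum_sub_distrib, Finset.mul_sum, Finset.mul_sum]
    apply Finset.sum_congr rfl
    intro k hk
    simp only [u]
    obtain ⟨n, rfl⟩ : ∃ n, p = n + k := ⟨p - k, by simp at hk; omega⟩
    have s1 : 2 * (n + k) - 2 * k = 2 * n := by omega
    have e1 : x - ((n + k : ℕ) : ℝ) + k + 1 = x - n + 1 := by push_cast; ring
    have e2 : x - 1 - ((n + k : ℕ) : ℝ) + k = x - n - 1 := by push_cast; ring
    have e3 : x - ((n + k : ℕ) : ℝ) + k - 1 = x - n - 1 := by push_cast; ring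
    have e4 : ((n + k : ℕ) : ℝ) - k = n := by push_cast; ring
    rw [s1, e1, e2, e3, e4]
    have q1 : poch (x - n - 1) (2 * n + 3) =
        (x - n - 1) * (x - n) * poch (x - n + 1) (2 * n + 1) := by
      rw [poch_succ', poch_succ']; ring_nf
    have q2 : poch (x - n - 1) (2 * n + 3) =
        poch (x - n - 1) (2 * n + 1) * (x + n) * (x + n + 1) := by
      rw [poch_succ, poch_succ]; push_cast; ring
    have h1 : x - n ≠ 0 := by simpa [sub_eq_add_neg] using half_ne' x m hx (-n)
    have h1' : x - n - 1 ≠ 0 := by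
      have := half_ne' x m hx (-n - 1)
      push_cast at this
      intro h; apply this; linarith
    have h2 : x + n ≠ 0 := by simpa using half_ne' x m hx n
    have h2' : x + n + 1 ≠ 0 := by
      have := half_ne' x m hx (n + 1)
      push_cast at this
      intro h; apply this; linarith
    have h3 : poch (x - n - 1) (2 * n + 3) ≠ 0 :=
      poch_half_ne _ (m - n - 1) (by rw [hx]; push_cast; ring) _
    have r1 : poch (x - n + 1) (2 * n + 1) =
        poch (x - n - 1) (2 * n + 3) / ((x - n - 1) * (x - n)) := by
      rw [q1]; field_simp
    have r2 : poch (x - n - 1) (2 * n + 1) =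
        poch (x - n - 1) (2 * n + 3) / ((x + n) * (x + n + 1)) := by
      rw [q2]; field_simp
    rw [r1, r2]
    generalize poch (x - n - 1) (2 * n + 3) = Q at *
    have : z ^ 2 * w ^ (k + 1) = w ^ k := by
      linear_combination w ^ k * hzw
    rw [← this]
    generalize w ^ (k + 1) = W
    field_simp
    ring
  have hv : 2 * x * (x * BB p x w - CC p (x - 1) w) = - ∑ k ∈ range (p + 1), v k := by
    unfold CC BB
    rw [Finset.mul_sum, ← Finset.sum_sub_distrib, Finset.mul_sum, ← Finset.sum_neg_distrib]
    apply Finset.sum_congr rfl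
    intro k hk
    simp only [v]
    obtain ⟨n, rfl⟩ : ∃ n, p = n + k := ⟨p - k, by simp at hk; omega⟩
    have s1 : 2 * (n + k) - 2 * k = 2 * n := by omega
    have e2 : x - 1 - ((n + k : ℕ) : ℝ) + k + 1 = x - n := by push_cast; ring
    have e3 : x - ((n + k : ℕ) : ℝ) + k = x - n := by push_cast; ring
    have e4 : ((n + k : ℕ) : ℝ) - k = n := by push_cast; ring
    rw [s1, e2, e3, e4]
    have q2 : poch (x - n) (2 * n + 1) = poch (x - n) (2 * n) * (x + n) := by
      rw [poch_succ]; push_cast; ring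
    have h2 : x + n ≠ 0 := by simpa using half_ne' x m hx n
    have h3 : poch (x - n) (2 * n + 1) ≠ 0 :=
      poch_half_ne _ (m - n) (by rw [hx]; push_cast; ring) _
    have r2 : poch (x - n) (2 * n) = poch (x - n) (2 * n + 1) / (x + n) := by
      rw [q2]; field_simp
    rw [r2]
    field_simp
    ring
  rw [hu, hv, Finset.sum_range_succ', Finset.sum_range_succ]
  have hvp : v p = 0 := by simp [v]
  have hu0 : u 0 = 2 * x / poch (x - p - 1) (2 * p + 3) := by
    have hp : (p : ℝ) + 1 / 2 ≠ 0 := by positivity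
    simp only [u, cc_zero]
    simp only [Nat.cast_zero, mul_zero, Nat.sub_zero, add_zero, sub_zero, pow_zero, mul_one]
    congr 1
    field_simp
  have huv : ∑ k ∈ range p, u (k + 1) = ∑ k ∈ range p, v k := by
    apply Finset.sum_congr rfl
    intro k hk
    obtain ⟨n, rfl⟩ : ∃ n, p = n + 1 + k := ⟨p - k - 1, by simp at hk; omega⟩
    simp only [u, v]
    have s1 : 2 * (n + 1 + k) - 2 * (k + 1) + 3 = 2 * n + 3 := by omega
    have s2 : 2 * (n + 1 + k) - 2 * k + 1 = 2 * n + 3 := by omega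
    have e1 : x - ((n + 1 + k : ℕ) : ℝ) + (k + 1 : ℕ) - 1 = x - n - 1 := by push_cast; ring
    have e2 : x - ((n + 1 + k : ℕ) : ℝ) + k = x - n - 1 := by push_cast; ring
    rw [s1, s2, e1, e2]
    congr 2
    have := cc_rec k n
    push_cast
    linear_combination 2 * x * this
  rw [huv, hvp, hu0]
  ring

/-- the boundary term, index shifted by one -/
noncomputable def GG (p m : ℕ) (z : ℝ) : ℝ :=
  z ^ 2 * (-(1 / 2) * AA p (m - 1 / 2) ((z ^ 2)⁻¹)) * sphjAux z m ^ 2 +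
  z ^ 2 * (-(1 / 2) * BB p (m - 1 / 2) ((z ^ 2)⁻¹)) * sphjAux z (m + 1) ^ 2 +
  z * CC p (m - 1 / 2) ((z ^ 2)⁻¹) * sphjAux z m * sphjAux z (m + 1)

lemma GG_step (p m : ℕ) (z : ℝ) (hz : z ≠ 0) :
    GG p (m + 1) z = GG p m z +
      (2 * (m : ℝ) + 1) / poch ((m : ℝ) - p - 1 / 2) (2 * p + 3) * sphjAux z (m + 1) ^ 2 := by
  have hx : (m : ℝ) + 1 / 2 = (m : ℤ) + 1 / 2 := by push_cast; ring
  have hd := diag p (m + 1 / 2) z hz m hx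
  have hc := CB p (m + 1 / 2) ((z ^ 2)⁻¹) m hx
  have ha := AB p (m + 1 / 2) ((z ^ 2)⁻¹)
  unfold GG
  have e1 : ((m + 1 : ℕ) : ℝ) - 1 / 2 = m + 1 / 2 := by push_cast; ring
  have e2 : (m : ℝ) + 1 / 2 - 1 = m - 1 / 2 := by ring
  have e3 : (m : ℝ) - p - 1 / 2 = m + 1 / 2 - p - 1 := by ring
  have e4 : 2 * (m : ℝ) + 1 = 2 * (m + 1 / 2) := by ring
  rw [e1, e3, e4, ← hd, e2]
  rw [e2] at hc ha
  rw [ha]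
  have hj : sphjAux z (m + 1 + 1) = ((2 * (m : ℝ) + 1) / z) * sphjAux z (m + 1) - sphjAux z m := rfl
  have hj' : z * sphjAux z m = (2 * (m : ℝ) + 1) * sphjAux z (m + 1) - z * sphjAux z (m + 1 + 1) := by
    rw [hj]; field_simp; ring
  have hj2 : sphjAux z m = ((2 * (m : ℝ) + 1) * sphjAux z (m + 1) - z * sphjAux z (m + 1 + 1)) / z := by
    rw [← hj']; field_simp
  have hC : CC p (m + 1 / 2) ((z ^ 2)⁻¹) =
    2 * (m + 1 / 2) * BB p (m + 1 / 2) ((z ^ 2)⁻¹) - CC p (m - 1 / 2) ((z ^ 2)⁻¹) := by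
    linarith
  rw [hC, hj2]
  generalize sphjAux z (m + 1) = J1
  generalize sphjAux z (m + 1 + 1) = J2
  generalize AA p (m + 1 / 2) ((z ^ 2)⁻¹) = a
  generalize BB p (m + 1 / 2) ((z ^ 2)⁻¹) = b
  generalize CC p (m - 1 / 2) ((z ^ 2)⁻¹) = c
  generalize BB p (m - 1 / 2) ((z ^ 2)⁻¹) = d
  field_simp
  ring

/-- abstract sum -/
noncomputable def VV (b : ℕ → ℝ) (p : ℕ) : ℝ :=
  ∑ k ∈ range (p + 1), b (k + 2) / ((p - k).factorial : ℝ)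

lemma VV_rec (b : ℕ → ℝ) (w : ℝ)
    (hb : ∀ m, b (m + 2) = -w * ((m + 1 / 2) * b (m + 1) + b m)) (p : ℕ) :
    VV b (p + 1) = -(p + 3 / 2) * w * VV b p -
      w / ((p + 1).factorial : ℝ) * ((p + 3 / 2) * b 1 + b 0) := by
  have h1 : VV b (p + 1) = -w * (∑ k ∈ range (p + 2), (k + 1 / 2) * b (k + 1) / ((p + 1 - k).factorial : ℝ)
      + ∑ k ∈ range (p + 2), b k / ((p + 1 - k).factorial : ℝ)) := by
    unfold VV
    rw [← Finset.sum_add_distrib, Finset.mul_sum]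
    apply Finset.sum_congr rfl
    intro k _
    rw [hb]
    ring
  have h2 : ∑ k ∈ range (p + 2), ((k : ℝ) + 1 / 2) * b (k + 1) / ((p + 1 - k).factorial : ℝ)
      = ∑ k ∈ range (p + 1), ((k : ℝ) + 3 / 2) * b (k + 2) / ((p - k).factorial : ℝ)
        + 1 / 2 * b 1 / ((p + 1).factorial : ℝ) := by
    rw [Finset.sum_range_succ']
    congr 1
    · apply Finset.sum_congr rfl
      intro k _
      rw [Nat.add_sub_add_right]
      push_cast
      ring
    · simp
  have h3 : ∑ k ∈ range (p + 2), b k / ((p + 1 - k).factorial : ℝ)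
      = ∑ k ∈ range (p + 1), ((p : ℝ) - k) * b (k + 2) / ((p - k).factorial : ℝ)
        + b 1 / (p.factorial : ℝ) + b 0 / ((p + 1).factorial : ℝ) := by
    rw [Finset.sum_range_succ', Finset.sum_range_succ', Finset.sum_range_succ]
    have : ∑ k ∈ range p, b (k + 1 + 1) / ((p + 1 - (k + 1 + 1)).factorial : ℝ) =
        ∑ k ∈ range p, ((p : ℝ) - k) * b (k + 2) / ((p - k).factorial : ℝ) := by
      apply Finset.sum_congr rfl
      intro k hk
      obtain ⟨n, rfl⟩ : ∃ n, p = n + 1 + k := ⟨p - k - 1, by simp at hk; omega⟩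
      have s1 : n + 1 + k + 1 - (k + 1 + 1) = n := by omega
      have s2 : n + 1 + k - k = n + 1 := by omega
      rw [s1, s2, Nat.factorial_succ]
      have : (n.factorial : ℝ) ≠ 0 := by positivity
      push_cast
      field_simp
      ring
    rw [this]
    simp
  rw [h1, h2, h3]
  have h4 : ∑ k ∈ range (p + 1), ((k : ℝ) + 3 / 2) * b (k + 2) / ((p - k).factorial : ℝ) +
      ∑ k ∈ range (p + 1), ((p : ℝ) - k) * b (k + 2) / ((p - k).factorial : ℝ) =
      (p + 3 / 2) * VV b p := by
    unfold VV
    rw [← Finset.sum_add_distrib, Finset.mul_sum]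
    apply Finset.sum_congr rfl
    intro k _
    ring
  have h5 : b 1 / (p.factorial : ℝ) = (p + 1) * b 1 / ((p + 1).factorial : ℝ) := by
    rw [Nat.factorial_succ]
    have : (p.factorial : ℝ) ≠ 0 := by positivity
    push_cast
    field_simp
  rw [h5]
  linear_combination (-w) * h4

noncomputable def YY (b : ℕ → ℝ) (w : ℝ) (p : ℕ) : ℝ :=
  ∑ k ∈ range (p + 1), w ^ (k + 1) * (-1) ^ (p - k) /
    (((p - k).factorial : ℝ) * poch (1 / 2) (p - k + 1)) * (b 0 + (((p - k : ℕ) : ℝ) + 1 / 2) * b 1)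

lemma h_ne (n : ℕ) : poch (1 / 2) n ≠ 0 := poch_half_ne _ 0 (by simp) n

lemma YY_succ (b : ℕ → ℝ) (w : ℝ) (p : ℕ) : YY b w (p + 1) = w * YY b w p +
    w * (-1) ^ (p + 1) / (((p + 1).factorial : ℝ) * poch (1 / 2) (p + 2)) * (b 0 + (p + 3 / 2) * b 1) := by
  unfold YY
  rw [Finset.sum_range_succ', Finset.mul_sum]
  congr 1
  · apply Finset.sum_congr rfl
    intro k _
    rw [Nat.add_sub_add_right]
    ring
  · simp only [Nat.sub_zero]
    push_cast
    ring

lemma VV_eq (b : ℕ → ℝ) (w : ℝ)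
    (hb : ∀ m, b (m + 2) = -w * ((m + 1 / 2) * b (m + 1) + b m)) (p : ℕ) :
    VV b p = -(-1) ^ p * poch (1 / 2) (p + 1) * YY b w p := by
  induction p with
  | zero =>
    have := hb 0
    simp [VV, YY, poch, this]
    ring
  | succ p ih =>
    rw [VV_rec b w hb, ih, YY_succ, poch_succ _ (p + 1)]
    have h1 := h_ne (p + 1)
    have h2 : (1 / 2 : ℝ) + ((p + 1 : ℕ) : ℝ) ≠ 0 := by positivity
    have h3 : (((p + 1).factorial : ℕ) : ℝ) ≠ 0 := by positivity
    have h4 : ((-1 : ℝ) ^ p) * (-1) ^ p = 1 := by rw [← mul_pow]; simp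
    have h5 : (1 / 2 : ℝ) + ((p + 1 : ℕ) : ℝ) = p + 3 / 2 := by push_cast; ring
    rw [h5] at h2 ⊢
    generalize (((p + 1).factorial : ℕ) : ℝ) = F at *
    generalize poch (1 / 2) (p + 1) = H at *
    rw [pow_succ]
    generalize (-1 : ℝ) ^ p = s at *
    have e : -(s * -1) * (H * (↑p + 3 / 2)) * (w * YY b w p + w * (s * -1) / (F * (H * (↑p + 3 / 2))) * (b 0 + (↑p + 3 / 2) * b 1))
      = s * H * (p + 3 / 2) * w * YY b w p - (s * s) * w / F * (b 0 + (↑p + 3 / 2) * b 1) := by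
      field_simp
      ring
    rw [e, h4]
    ring

lemma poch_center (n : ℕ) : poch (-(n : ℝ) + 1 / 2) (2 * n) = (-1) ^ n * poch (1 / 2) n ^ 2 := by
  induction n with
  | zero => simp [poch]
  | succ n ih =>
    have : 2 * (n + 1) = 2 * n + 1 + 1 := by ring
    rw [this, poch_succ, poch_succ']
    have e : -((n + 1 : ℕ) : ℝ) + 1 / 2 + 1 = -(n : ℝ) + 1 / 2 := by push_cast; ring
    rw [e, ih, poch_succ]
    push_cast
    ring

lemma poch_fact (n k : ℕ) : poch ((n : ℝ) + 1) k * (n.factorial : ℝ) = ((n + k).factorial : ℝ) := by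
  induction k with
  | zero => simp [poch]
  | succ k ih =>
    rw [poch_succ, ← add_assoc, Nat.factorial_succ]
    push_cast
    rw [← ih]
    ring

lemma poch_h (n k : ℕ) : poch ((n : ℝ) + 1 / 2) k * poch (1 / 2) n = poch (1 / 2) (n + k) := by
  induction k with
  | zero => simp [poch]
  | succ k ih =>
    rw [poch_succ, ← add_assoc, poch_succ, ← ih]
    push_cast
    ring

lemma base (p : ℕ) (z : ℝ) (hz : z ≠ 0) :
    GG p 0 z + 1 / poch (-(p : ℝ) - 1 / 2) (2 * p + 2) *
          ∑ k ∈ Finset.range (p + 1),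
            (-1 : ℝ) ^ k * poch ((p : ℝ) - k + 1) k * z ^ (-((k : ℤ) + 1)) *
              sphjAux (2 * z) (k + 2) = 0 := by
  let b : ℕ → ℝ := fun m => -z * (-z⁻¹) ^ m * sphjAux (2 * z) m
  set w := (z ^ 2)⁻¹ with hw
  have hb : ∀ m, b (m + 2) = -w * ((m + 1 / 2) * b (m + 1) + b m) := by
    intro m
    simp only [b]
    rw [sphjAux, hw]
    simp only [pow_succ]
    generalize (-z⁻¹) ^ m = q
    field_simp
    ring
  have hV := VV_eq b w hb p
  have hH := h_ne (p + 1)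
  have hss : ((-1 : ℝ) ^ p) * (-1) ^ p = 1 := by rw [← mul_pow]; simp
  have hS : 1 / poch (-(p : ℝ) - 1 / 2) (2 * p + 2) *
          ∑ k ∈ Finset.range (p + 1),
            (-1 : ℝ) ^ k * poch ((p : ℝ) - k + 1) k * z ^ (-((k : ℤ) + 1)) *
              sphjAux (2 * z) (k + 2) =
      (-1) ^ p * p.factorial / poch (1 / 2) (p + 1) ^ 2 * VV b p := by
    have hc := poch_center (p + 1)
    have e : -((p + 1 : ℕ) : ℝ) + 1 / 2 = -(p : ℝ) - 1 / 2 := by push_cast; ring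
    rw [e] at hc
    have hsum : ∑ k ∈ Finset.range (p + 1),
            (-1 : ℝ) ^ k * poch ((p : ℝ) - k + 1) k * z ^ (-((k : ℤ) + 1)) *
              sphjAux (2 * z) (k + 2) = - p.factorial * VV b p := by
      unfold VV
      rw [Finset.mul_sum]
      apply Finset.sum_congr rfl
      intro k hk
      obtain ⟨n, rfl⟩ : ∃ n, p = n + k := ⟨p - k, by simp at hk; omega⟩
      have e4 : ((n + k : ℕ) : ℝ) - k = n := by push_cast; ring
      rw [e4, ← poch_fact n k, Nat.add_sub_cancel]
      have hF : (n.factorial : ℝ) ≠ 0 := by positivity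
      have hzp : z ^ (-((k : ℤ) + 1)) = z⁻¹ ^ (k + 1) := by
        rw [zpow_neg, inv_pow]
        norm_cast
      rw [hzp]
      simp only [b]
      rw [neg_pow z⁻¹ (k + 2)]
      simp only [pow_succ]
      field_simp
    rw [hsum, show 2 * p + 2 = 2 * (p + 1) by ring, hc, pow_succ]
    generalize (-1 : ℝ) ^ p = s at *
    have hs : s ≠ 0 := by rintro rfl; simp at hss
    generalize poch (1 / 2) (p + 1) = H at *
    field_simp
    linear_combination (-VV b p) * hss
  have hG : GG p 0 z = p.factorial / poch (1 / 2) (p + 1) * YY b w p := by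
    unfold GG AA BB CC YY
    rw [← hw]
    simp only [Finset.mul_sum, Finset.sum_mul]
    rw [← Finset.sum_add_distrib, ← Finset.sum_add_distrib]
    apply Finset.sum_congr rfl
    intro k hk
    obtain ⟨n, rfl⟩ : ∃ n, p = n + k := ⟨p - k, by simp at hk; omega⟩
    have s1 : 2 * (n + k) - 2 * k = 2 * n := by omega
    have e1 : ((0 : ℕ) : ℝ) - 1 / 2 - ((n + k : ℕ) : ℝ) + k + 1 = - n + 1 / 2 := by
      push_cast; ring
    have e2 : ((0 : ℕ) : ℝ) - 1 / 2 - ((n + k : ℕ) : ℝ) + k = - n - 1 / 2 := by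
      push_cast; ring
    have e4 : ((n + k : ℕ) : ℝ) - k = n := by push_cast; ring
    rw [s1, e1, e2, Nat.add_sub_cancel, cc, e4]
    have q1 : poch (-(n : ℝ) + 1 / 2) (2 * n + 1) = (-1) ^ n * poch (1 / 2) n ^ 2 * (n + 1 / 2) := by
      rw [poch_succ, poch_center]; push_cast; ring
    have q2 : poch (-(n : ℝ) - 1 / 2) (2 * n + 1) = - ((-1) ^ n * poch (1 / 2) n ^ 2 * (n + 1 / 2)) := by
      rw [poch_succ', show -(n : ℝ) - 1 / 2 + 1 = -n + 1 / 2 by ring, poch_center]; ring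
    rw [q1, q2, poch_center, poch_succ _ n, ← poch_fact n k, add_assoc n k 1, ← poch_h n (k + 1)]
    have hF : (n.factorial : ℝ) ≠ 0 := by positivity
    have hn : (n : ℝ) + 1 / 2 ≠ 0 := by positivity
    have hn' : (1 / 2 : ℝ) + n = n + 1 / 2 := by ring
    rw [hn']
    have hh := h_ne n
    have hq : poch ((n : ℝ) + 1 / 2) (k + 1) ≠ 0 := poch_half_ne _ n (by push_cast; ring) _
    have hb0 : b 0 = -(1 / 2) * (Real.cos z ^ 2 - Real.sin z ^ 2) := by
      simp only [b, sphjAux]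
      rw [Real.cos_two_mul']
      field_simp
      try ring
    have hb1 : b 1 = Real.sin z * Real.cos z / z := by
      simp only [b, sphjAux]
      rw [Real.sin_two_mul]
      field_simp
      try ring
    rw [hb0, hb1]
    simp only [sphjAux, zero_add]
    have hsn : ((-1 : ℝ) ^ n) * (-1) ^ n = 1 := by rw [← mul_pow]; simp
    have hsi : ((-1 : ℝ) ^ n) = ((-1 : ℝ) ^ n)⁻¹ := eq_inv_of_mul_eq_one_left hsn
    generalize (-1 : ℝ) ^ n = s at *
    have hs : s ≠ 0 := by rintro rfl; simp at hsn
    have hs2 : s ^ 2 = 1 := by rw [pow_two]; exact hsn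
    generalize poch ((n : ℝ) + 1 / 2) (k + 1) = Q at *
    generalize poch (1 / 2) n = H at *
    generalize w ^ (k + 1) = W
    generalize poch ((n : ℝ) + 1) k = P
    generalize (n : ℝ) + 1 / 2 = N at *
    generalize (n.factorial : ℝ) = F at *
    have : W * s = W / s := by rw [div_eq_mul_inv, ← hsi]
    rw [this]
    field_simp
    ring
  rw [hG, hS, hV]
  generalize (-1 : ℝ) ^ p = s at *
  generalize poch (1 / 2) (p + 1) = H at *
  have : s * ↑p.factorial / H ^ 2 * (-s * H * YY b w p) = -(s * s) * (p.factorial / H * YY b w p) := by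
    field_simp
  rw [this, hss]
  ring

lemma main_aux (p m : ℕ) (z : ℝ) (hz : z ≠ 0) :
    ∑ k ∈ Finset.range m,
        (2 * (k : ℝ) + 1) / poch ((k : ℝ) - p - 1 / 2) (2 * p + 3) * (sphjAux z (k + 1)) ^ 2 =
      GG p m z + 1 / poch (-(p : ℝ) - 1 / 2) (2 * p + 2) *
          ∑ k ∈ Finset.range (p + 1),
            (-1 : ℝ) ^ k * poch ((p : ℝ) - k + 1) k * z ^ (-((k : ℤ) + 1)) *
              sphjAux (2 * z) (k + 2) := by
  induction m with
  | zero => rw [base p z hz]; simp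
  | succ m ih =>
    rw [Finset.sum_range_succ, ih, GG_step p m z hz]
    ring

/-- The first hierarchy of sum rules. -/
theorem first_hierarchy_sum_rule (z : ℝ) (hz : z ≠ 0) (p ℓ : ℕ) :
    ∑ k ∈ Finset.range (ℓ + 1),
        (2 * (k : ℝ) + 1) / poch ((k : ℝ) - p - 1 / 2) (2 * p + 3) * (sphj k z) ^ 2 =
      z ^ 2 * A1 p ℓ z * (sphj ℓ z) ^ 2 + z ^ 2 * B1 p ℓ z * (sphj (ℓ + 1) z) ^ 2 +
        z * C1 p ℓ z * sphj ℓ z * sphj (ℓ + 1) z +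
        1 / poch (-(p : ℝ) - 1 / 2) (2 * p + 2) *
          ∑ k ∈ Finset.range (p + 1),
            (-1 : ℝ) ^ k * poch ((p : ℝ) - k + 1) k * z ^ (-((k : ℤ) + 1)) *
              sphj (k + 1) (2 * z) := by
  have c1 : ∀ (k : ℕ) (y : ℝ), sphj (k : ℤ) y = sphjAux y (k + 1) := by
    intro k y
    rfl
  have c2 : ∀ (k : ℕ) (y : ℝ), sphj ((k : ℤ) + 1) y = sphjAux y (k + 2) := by
    intro k y
    rfl
  have h := main_aux p (ℓ + 1) z hz
  simp only [c1, c2]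
  rw [h, GG, A1_eq, B1_eq, C1_eq]
  have e : ((ℓ + 1 : ℕ) : ℝ) - 1 / 2 = ℓ + 1 / 2 := by push_cast; ring
  rw [e]
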